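/- Let d ≥ 1, let P⁰, P¹ be d×d row-stochastic matrices, R⁰, R¹ ∈ ℝ^d, m ∈ Δ^d, T ≥ 1, and let γ_0, …, γ_{T−1} ∈ ℝ. Define Q-values by backward recursion: V_s(T) = 0 for all s; for 0 ≤ t ≤ T−1, Q_{s,a}(t) = R^a_s − a γ_t + Σ_{s'} P^a_{s,s'} V_{s'}(t+1) for a ∈ {0,1}, and V_s(t) = max(Q_{s,0}(t), Q_{s,1}(t)); set I_s(t) = Q_{s,1}(t) − Q_{s,0}(t). Let y* be an optimal solution of the Lagrangian LP, maximizing Σ_{t=0}^{T−1} Σ_{s,a} (R^a_s − a γ_t) y_{s,a}(t) over nonnegative y subject to the flow constraints y_{s,0}(t+1)+y_{s,1}(t+1) = Σ_{s',a} y_{s',a}(t) P^a_{s',s} and the initial condition y_{s,0}(0)+y_{s,1}(0) = m_s. Then for every t and s: if y*_{s,1}(t) > 0 and y*_{s,0}(t) = 0 then I_s(t) ≥ 0; if y*_{s,1}(t) = 0 and y*_{s,0}(t) > 0 then I_s(t) ≤ 0; and if y*_{s,1}(t) > 0 and y*_{s,0}(t) > 0 then I_s(t) = 0. -/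

import Mathlib

/-- The feasible region of the Lagrangian LP: flow constraints, initial condition
and nonnegativity (no budget constraints). -/
def rbLagFeasible (d T : ℕ) (P : Fin 2 → Matrix (Fin d) (Fin d) ℝ)
    (m : Fin d → ℝ) : Set (Fin T → Fin d → Fin 2 → ℝ) :=
  {y | (∀ t s a, 0 ≤ y t s a) ∧
    (∀ (t : ℕ) (ht : t + 1 < T) (s : Fin d),
      y ⟨t + 1, ht⟩ s 0 + y ⟨t + 1, ht⟩ s 1 =
        ∑ s', ∑ a, y ⟨t, Nat.lt_of_succ_lt ht⟩ s' a * P a s' s) ∧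
    (∀ (ht : 0 < T) (s : Fin d), y ⟨0, ht⟩ s 0 + y ⟨0, ht⟩ s 1 = m s)}

/-- The Lagrangian objective with multipliers `γ_t`. -/
def rbLagObjective (d T : ℕ) (R : Fin 2 → Fin d → ℝ) (γ : Fin T → ℝ)
    (y : Fin T → Fin d → Fin 2 → ℝ) : ℝ :=
  ∑ t, ∑ s, ∑ a, (R a s - (a.val : ℝ) * γ t) * y t s a

theorem rb_obj_eq (d T : ℕ) (P : Fin 2 → Matrix (Fin d) (Fin d) ℝ)
    (R : Fin 2 → Fin d → ℝ) (γ : Fin T → ℝ)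
    (V : ℕ → Fin d → ℝ) (Q : Fin T → Fin d → Fin 2 → ℝ)
    (hVT : ∀ s, V T s = 0)
    (hQ : ∀ (t : Fin T) (s : Fin d) (a : Fin 2),
      Q t s a = R a s - (a.val : ℝ) * γ t + ∑ s', P a s s' * V (t.val + 1) s')
    (y : Fin T → Fin d → Fin 2 → ℝ) (x : ℕ → Fin d → ℝ)
    (hx : ∀ (t : Fin T) s, y t s 0 + y t s 1 = x t.val s)
    (hx' : ∀ (t : Fin T) s, x (t.val + 1) s = ∑ s', ∑ a, y t s' a * P a s' s) :
    rbLagObjective d T R γ y = ∑ s, x 0 s * V 0 s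
      - ∑ t, ∑ s, ∑ a, (V t.val s - Q t s a) * y t s a := by
  have key : ∀ t : Fin T, ∑ s, ∑ a, (R a s - (a.val : ℝ) * γ t) * y t s a
      + ∑ s, ∑ a, (V t.val s - Q t s a) * y t s a
      = ∑ s, x t.val s * V t.val s - ∑ s, x (t.val + 1) s * V (t.val + 1) s := by
    intro t
    have h1 : ∑ s, x (t.val + 1) s * V (t.val + 1) s
        = ∑ s, ∑ a, y t s a * ∑ s', P a s s' * V (t.val + 1) s' := by
      simp only [hx', Finset.sum_mul, Finset.mul_sum]
      rw [Finset.sum_comm]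
      refine Finset.sum_congr rfl fun s _ => ?_
      rw [Finset.sum_comm]
      refine Finset.sum_congr rfl fun a _ => Finset.sum_congr rfl fun s' _ => by ring
    rw [h1, ← Finset.sum_add_distrib, ← Finset.sum_sub_distrib]
    refine Finset.sum_congr rfl fun s _ => ?_
    rw [← hx t s]
    simp only [Fin.sum_univ_two, hQ]
    ring
  have tel : ∑ t : Fin T, (∑ s, x t.val s * V t.val s
      - ∑ s, x (t.val + 1) s * V (t.val + 1) s) = ∑ s, x 0 s * V 0 s := by
    rw [Fin.sum_univ_eq_sum_range
      (fun t => ∑ s, x t s * V t s - ∑ s, x (t + 1) s * V (t + 1) s) T,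
      Finset.sum_range_sub' (fun t => ∑ s, x t s * V t s)]
    simp [hVT]
  rw [eq_sub_iff_add_eq, ← tel, rbLagObjective, ← Finset.sum_add_distrib]
  exact Finset.sum_congr rfl fun t _ => key t

def rbGreedy (d T : ℕ) (π : ℕ → Fin d → Fin 2 → ℝ) (P : Fin 2 → Matrix (Fin d) (Fin d) ℝ)
    (m : Fin d → ℝ) : ℕ → Fin d → ℝ
  | 0 => m
  | t + 1 => fun s => ∑ s', ∑ a, rbGreedy d T π P m t s' * π t s' a * P a s' s

/-- Sign of the LP indices `I_s(t) = Q_{s,1}(t) − Q_{s,0}(t)`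
(defined through the backward Bellman recursion of the Lagrangian MDP) at an optimal
solution of the Lagrangian LP: states activated fully have nonnegative index, states
left fully passive have nonpositive index, and randomizing states have index zero. -/
theorem sign_of_LP_indices
    (d T : ℕ) (hd : 1 ≤ d) (hT : 1 ≤ T)
    (P : Fin 2 → Matrix (Fin d) (Fin d) ℝ)
    (hPnn : ∀ a s s', 0 ≤ P a s s')
    (hProw : ∀ a s, ∑ s', P a s s' = 1)
    (R : Fin 2 → Fin d → ℝ)
    (m : Fin d → ℝ) (hmnn : ∀ s, 0 ≤ m s) (hmsum : ∑ s, m s = 1)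
    (γ : Fin T → ℝ)
    (V : ℕ → Fin d → ℝ) (Q : Fin T → Fin d → Fin 2 → ℝ)
    (hVT : ∀ s, V T s = 0)
    (hQ : ∀ (t : Fin T) (s : Fin d) (a : Fin 2),
      Q t s a = R a s - (a.val : ℝ) * γ t + ∑ s', P a s s' * V (t.val + 1) s')
    (hV : ∀ (t : Fin T) (s : Fin d), V t.val s = max (Q t s 0) (Q t s 1))
    (ystar : Fin T → Fin d → Fin 2 → ℝ)
    (hmem : ystar ∈ rbLagFeasible d T P m)
    (hopt : ∀ z ∈ rbLagFeasible d T P m,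
      rbLagObjective d T R γ z ≤ rbLagObjective d T R γ ystar) :
    ∀ (t : Fin T) (s : Fin d),
      (0 < ystar t s 1 ∧ ystar t s 0 = 0 → 0 ≤ Q t s 1 - Q t s 0) ∧
      (ystar t s 1 = 0 ∧ 0 < ystar t s 0 → Q t s 1 - Q t s 0 ≤ 0) ∧
      (0 < ystar t s 1 ∧ 0 < ystar t s 0 → Q t s 1 - Q t s 0 = 0) := by
  classical
  set π : ℕ → Fin d → Fin 2 → ℝ := fun t s a =>
    if h : t < T then
      (if Q ⟨t, h⟩ s 0 ≤ Q ⟨t, h⟩ s 1 then (if a = 1 then 1 else 0) else (if a = 0 then 1 else 0))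
    else 0 with hπ
  have hπnn : ∀ t s a, 0 ≤ π t s a := by
    intro t s a
    simp only [hπ]
    split_ifs <;> norm_num
  have hπsum : ∀ (t : Fin T) s, π t.val s 0 + π t.val s 1 = 1 := by
    intro t s
    simp only [hπ, t.isLt, dif_pos]
    split_ifs <;> simp_all
  have hπgap : ∀ (t : Fin T) s a, (V t.val s - Q t s a) * π t.val s a = 0 := by
    intro t s a
    simp only [hπ, t.isLt, dif_pos, hV]
    by_cases h : Q t s 0 ≤ Q t s 1
    · fin_cases a <;> simp [h]
    · have h' := (not_le.mp h).le
      fin_cases a <;> simp [h, h']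
  set x := rbGreedy d T π P m with hx
  have hxnn : ∀ t s, 0 ≤ x t s := by
    intro t
    induction t with
    | zero => exact hmnn
    | succ t ih =>
      intro s
      exact Finset.sum_nonneg fun s' _ => Finset.sum_nonneg fun a _ =>
        mul_nonneg (mul_nonneg (ih s') (hπnn _ _ _)) (hPnn _ _ _)
  have hz1 : ∀ (t : Fin T) s, x t.val s * π t.val s 0 + x t.val s * π t.val s 1 = x t.val s := by
    intro t s
    rw [← mul_add, hπsum, mul_one]
  have hzmem : (fun (t : Fin T) s a => x t.val s * π t.val s a) ∈ rbLagFeasible d T P m := by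
    refine ⟨fun t s a => mul_nonneg (hxnn _ _) (hπnn _ _ _), ?_, ?_⟩
    · intro t ht s
      exact hz1 ⟨t + 1, ht⟩ s
    · intro ht s
      exact hz1 ⟨0, ht⟩ s
  have hz := rb_obj_eq d T P R γ V Q hVT hQ (fun (t : Fin T) s a => x t.val s * π t.val s a) x
    hz1 (fun t s => rfl)
  have hz0 : ∑ t : Fin T, ∑ s, ∑ a, (V t.val s - Q t s a) * (x t.val s * π t.val s a) = 0 := by
    refine Finset.sum_eq_zero fun t _ => Finset.sum_eq_zero fun s _ =>
      Finset.sum_eq_zero fun a _ => ?_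
    rw [mul_left_comm, hπgap, mul_zero]
  obtain ⟨hynn, hyflow, hyinit⟩ := hmem
  let w : ℕ → Fin d → ℝ := fun t => Nat.casesOn t m
    (fun t s => if h : t < T then ∑ s', ∑ a, ystar ⟨t, h⟩ s' a * P a s' s else 0)
  have hy := rb_obj_eq d T P R γ V Q hVT hQ ystar w
    (by
      rintro ⟨t, ht⟩ s
      cases t with
      | zero => exact hyinit ht s
      | succ t =>
        have : t < T := Nat.lt_of_succ_lt ht
        simp only [w, this, dif_pos]
        exact hyflow t ht s)
    (by
      intro t s
      simp only [w, t.isLt, dif_pos])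
  have hle := hopt _ hzmem
  rw [hz, hy, hz0] at hle
  have hw : w 0 = x 0 := rfl
  rw [hw] at hle
  have hnn : ∀ (t : Fin T) s a, 0 ≤ (V t.val s - Q t s a) * ystar t s a := by
    intro t s a
    refine mul_nonneg ?_ (hynn t s a)
    rw [hV, sub_nonneg]
    fin_cases a
    · exact le_max_left _ _
    · exact le_max_right _ _
  have hzero : ∀ (t : Fin T) s a, (V t.val s - Q t s a) * ystar t s a = 0 := by
    intro t s a
    refine le_antisymm ?_ (hnn t s a)
    have h1 := Finset.single_le_sum (f := fun a => (V t.val s - Q t s a) * ystar t s a)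
      (fun a _ => hnn t s a) (Finset.mem_univ a)
    have h2 := Finset.single_le_sum (f := fun s => ∑ a, (V t.val s - Q t s a) * ystar t s a)
      (fun s _ => Finset.sum_nonneg fun a _ => hnn t s a) (Finset.mem_univ s)
    have h3 := Finset.single_le_sum
      (f := fun t : Fin T => ∑ s, ∑ a, (V t.val s - Q t s a) * ystar t s a)
      (fun t _ => Finset.sum_nonneg fun s _ => Finset.sum_nonneg fun a _ => hnn t s a)
      (Finset.mem_univ t)
    linarith
  intro t s
  have key1 : 0 < ystar t s 1 → 0 ≤ Q t s 1 - Q t s 0 := by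
    intro h
    have h1 := (mul_eq_zero.mp (hzero t s 1)).resolve_right h.ne'
    have h2 := le_max_left (Q t s 0) (Q t s 1)
    rw [hV] at h1
    linarith
  have key0 : 0 < ystar t s 0 → Q t s 1 - Q t s 0 ≤ 0 := by
    intro h
    have h1 := (mul_eq_zero.mp (hzero t s 0)).resolve_right h.ne'
    have h2 := le_max_right (Q t s 0) (Q t s 1)
    rw [hV] at h1
    linarith
  exact ⟨fun h => key1 h.1, fun h => key0 h.2, fun h => le_antisymm (key0 h.2) (key1 h.1)⟩
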